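/- Let α > 0 and μ > 1. Let h : (0,∞) → (0,∞) be nonincreasing and regularly varying at infinity with index −α, i.e. for every c > 0, h(cx)/h(x) → c^{−α} as x → ∞. Let (γ_n) be a sequence of positive reals such that n^{−3}·γ_n → ∞ and μ^n·h(γ_n) → 0 as n → ∞. Then lim_{n→∞} n² · h(n^{−3} γ_n)² / h(γ_n) = 0. -/

import Mathlib

open Filter

/-- Iterating a doubling bound `h x ≤ 2 ^ N * h (2 * x)`. -/
lemma le_two_pow_mul_of_doubling {h : ℝ → ℝ} {N : ℕ} {x₀ : ℝ} (hx₀ : 0 < x₀)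
    (hd : ∀ x, x₀ ≤ x → h x ≤ 2 ^ N * h (2 * x)) (k : ℕ) {x : ℝ} (hx : x₀ ≤ x) :
    h x ≤ (2 ^ k) ^ N * h (2 ^ k * x) := by
  induction k with
  | zero => simp
  | succ k ih =>
    have hle : x₀ ≤ 2 ^ k * x :=
      hx.trans (le_mul_of_one_le_left (hx₀.le.trans hx) (one_le_pow₀ one_le_two))
    calc h x ≤ (2 ^ k) ^ N * h (2 ^ k * x) := ih
      _ ≤ (2 ^ k) ^ N * (2 ^ N * h (2 * (2 ^ k * x))) := by gcongr; exact hd _ hle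
      _ = (2 ^ (k + 1)) ^ N * h (2 ^ (k + 1) * x) := by
        rw [← mul_assoc, ← mul_pow, ← mul_assoc, pow_succ, mul_comm 2 ((2 : ℝ) ^ k)]

/-- A Potter-type bound for a nonincreasing regularly varying function, with a natural
exponent. -/
lemma exists_potter_bound {α : ℝ} {h : ℝ → ℝ} (hpos : ∀ x, 0 < x → 0 < h x)
    (hmono : ∀ x y, 0 < x → x ≤ y → h y ≤ h x)
    (hrv : Tendsto (fun x : ℝ => h (2 * x) / h x) atTop (nhds (2 ^ (-α)))) :
    ∃ (N : ℕ) (x₀ : ℝ), 0 < x₀ ∧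
      ∀ x, x₀ ≤ x → ∀ t, 1 ≤ t → h x ≤ (2 * t) ^ N * h (t * x) := by
  obtain ⟨N, hN⟩ := exists_nat_gt α
  have hlt : ((2 : ℝ) ^ N)⁻¹ < 2 ^ (-α) := by
    rw [← Real.rpow_natCast, ← Real.rpow_neg zero_le_two]
    exact Real.rpow_lt_rpow_of_exponent_lt one_lt_two (neg_lt_neg hN)
  obtain ⟨x₁, hx₁⟩ := eventually_atTop.1 (hrv.eventually (lt_mem_nhds hlt))
  have hx₀ : 0 < max x₁ 1 := lt_max_of_lt_right one_pos
  refine ⟨N, max x₁ 1, hx₀, fun x hx t ht => ?_⟩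
  have hd : ∀ y, max x₁ 1 ≤ y → h y ≤ 2 ^ N * h (2 * y) := fun y hy => by
    have hq := hx₁ y ((le_max_left _ _).trans hy)
    rw [lt_div_iff₀ (hpos y (hx₀.trans_le hy)), inv_mul_lt_iff₀ (by positivity)] at hq
    exact hq.le
  have hx' : 0 < x := hx₀.trans_le hx
  obtain ⟨k, hk, hk'⟩ := exists_nat_pow_near ht (one_lt_two (α := ℝ))
  have htx : 0 < t * x := mul_pos (one_pos.trans_le ht) hx'
  have hnn : 0 ≤ h (t * x) := (hpos _ htx).le
  calc h x ≤ (2 ^ (k + 1)) ^ N * h (2 ^ (k + 1) * x) :=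
        le_two_pow_mul_of_doubling hx₀ hd (k + 1) hx
    _ ≤ (2 ^ (k + 1)) ^ N * h (t * x) := by
        gcongr
        exact hmono _ _ htx (by gcongr)
    _ ≤ (2 * t) ^ N * h (t * x) := by
        gcongr
        rw [pow_succ']
        gcongr

/-- If `h` is nonincreasing, positive and regularly varying at infinity with index `−α`,
`μ > 1`, `γ_n / n³ → ∞` and `μ^n h(γ_n) → 0`, then `n² h(γ_n/n³)² / h(γ_n) → 0`. -/
theorem rate_two_big_jumps_tendsto_zero
    (α μ : ℝ) (hα : 0 < α) (hμ : 1 < μ)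
    (h : ℝ → ℝ) (hpos : ∀ x, 0 < x → 0 < h x)
    (hmono : ∀ x y, 0 < x → x ≤ y → h y ≤ h x)
    (hrv : ∀ c : ℝ, 0 < c →
      Tendsto (fun x : ℝ => h (c * x) / h x) atTop (nhds (c ^ (-α))))
    (γ : ℕ → ℝ) (hγpos : ∀ n, 0 < γ n)
    (hγ : Tendsto (fun n : ℕ => γ n / (n : ℝ) ^ 3) atTop atTop)
    (hμh : Tendsto (fun n : ℕ => μ ^ n * h (γ n)) atTop (nhds 0)) :
    Tendsto (fun n : ℕ => (n : ℝ) ^ 2 * h (γ n / (n : ℝ) ^ 3) ^ 2 / h (γ n))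
      atTop (nhds 0) := by
  obtain ⟨N, x₀, hx₀, hP⟩ := exists_potter_bound hpos hmono (hrv 2 two_pos)
  have hlim : Tendsto (fun n : ℕ =>
      4 ^ N * ((n : ℝ) ^ (2 + 6 * N) / μ ^ n) * (μ ^ n * h (γ n))) atTop (nhds 0) := by
    simpa using ((tendsto_pow_const_div_const_pow_of_one_lt (2 + 6 * N) hμ).const_mul
      ((4 : ℝ) ^ N)).mul hμh
  refine squeeze_zero' (Eventually.of_forall fun n => ?_) ?_ hlim
  · have := hpos _ (hγpos n)
    positivity
  filter_upwards [hγ.eventually_ge_atTop x₀, eventually_ge_atTop 1] with n hn hn1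
  have hn1' : (1 : ℝ) ≤ n := by exact_mod_cast hn1
  have hγn := hpos _ (hγpos n)
  have hb := hP _ hn ((n : ℝ) ^ 3) (one_le_pow₀ hn1')
  rw [mul_div_cancel₀ _ (by positivity)] at hb
  have hnn := (hpos _ (hx₀.trans_le hn)).le
  have hμn : μ ^ n ≠ 0 := by positivity
  rw [div_le_iff₀ hγn]
  calc (n : ℝ) ^ 2 * h (γ n / (n : ℝ) ^ 3) ^ 2
      ≤ (n : ℝ) ^ 2 * ((2 * (n : ℝ) ^ 3) ^ N * h (γ n)) ^ 2 := by gcongr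
    _ = 4 ^ N * ((n : ℝ) ^ (2 + 6 * N) / μ ^ n) * (μ ^ n * h (γ n)) * h (γ n) := by
      have h4 : (4 : ℝ) ^ N = 2 ^ (2 * N) := by rw [pow_mul]; norm_num
      rw [h4]
      field_simp
      ring
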